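/- For $a>1$ and $j\in\mathbb{N}$ let $\eta_j^{a,0}\in L_2(0,1)$ be the 1-periodic function with Fourier coefficients $\widehat{\eta}_j^{a,0}(k)=e^{2\pi i 2^{-j-1}k}\sqrt{1-\exp\big(-\tfrac{2(k^2+a^2)}{j(j+1)a}\big)}\,\exp\big(-\tfrac{k^2+a^2}{(j+1)a}\big)$. Then for every fixed $a>1$, $\lim_{j\to\infty}UC(\eta_j^{a,0})=3/2$. -/

import Mathlib

open Filter

noncomputable section

/-- The sum `∑ₖ cₖ · conj c_{k+1}` appearing in the first trigonometric moment. -/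
def trigSum (c : ℤ → ℂ) : ℂ := ∑' k : ℤ, c k * (starRingEnd ℂ) (c (k + 1))

/-- The first trigonometric moment `τ(f) = -2π ∑ₖ cₖ · conj c_{k+1}`. -/
def tau (c : ℤ → ℂ) : ℂ := -2 * Real.pi * trigSum c

/-- The angular variance of a 1-periodic function given by its Fourier coefficients. -/
def varA (c : ℤ → ℂ) : ℝ :=
  (1 / (4 * Real.pi ^ 2)) *
    ((∑' k : ℤ, ‖c k‖ ^ 2) ^ 2 / ‖trigSum c‖ ^ 2 - 1)

/-- The frequency variance of a 1-periodic function given by its Fourier coefficients. -/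
def varF (c : ℤ → ℂ) : ℝ :=
  (4 * Real.pi ^ 2 * ∑' k : ℤ, (k : ℝ) ^ 2 * ‖c k‖ ^ 2) / (∑' k : ℤ, ‖c k‖ ^ 2) -
    (4 * Real.pi ^ 2 * (∑' k : ℤ, (k : ℝ) * ‖c k‖ ^ 2) ^ 2) /
      (∑' k : ℤ, ‖c k‖ ^ 2) ^ 2

/-- The Breitenberger (periodic) uncertainty constant. -/
def UC (c : ℤ → ℂ) : ℝ := Real.sqrt (varA c * varF c)

/-- Fourier coefficients of the auxiliary wavelet-type function `η_j^{a,0}`. -/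
def etaHat (j : ℕ) (a : ℝ) (k : ℤ) : ℂ :=
  Complex.exp (2 * Real.pi * Complex.I * (((2:ℝ) ^ (-(j:ℝ) - 1) : ℝ) : ℂ) * k) *
    ((Real.sqrt (1 - Real.exp (-(2 * ((k:ℝ) ^ 2 + a ^ 2) / ((j:ℝ) * ((j:ℝ) + 1) * a)))) *
      Real.exp (-(((k:ℝ) ^ 2 + a ^ 2) / (((j:ℝ) + 1) * a))) : ℝ) : ℂ)

open MeasureTheory Topology

lemma eta_hasSum_floor (h : ℝ) (hh : 0 < h) (F : ℤ → ℝ)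
    (hi : Integrable (fun x : ℝ => F ⌊x / h⌋)) :
    HasSum (fun k => h * F k) (∫ x : ℝ, F ⌊x / h⌋) := by
  have hi' : Integrable (fun x : ℝ => F ⌊x⌋) := by
    have := hi.comp_mul_right' hh.ne'
    refine this.congr (Eventually.of_forall fun x => ?_)
    simp [hh.ne']
  have h1 : (∫ x : ℝ, F ⌊x / h⌋) = h * ∫ x : ℝ, F ⌊x⌋ := by
    rw [Measure.integral_comp_div (fun x : ℝ => F ⌊x⌋) h, abs_of_pos hh, smul_eq_mul]
  rw [h1]
  apply HasSum.mul_left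
  have h2 := hasSum_integral_iUnion (μ := volume) (f := fun x : ℝ => F ⌊x⌋)
    (s := fun n : ℤ => Set.Ico (n : ℝ) (n + 1)) (fun _ => measurableSet_Ico)
    (Set.pairwise_disjoint_Ico_intCast ℝ) (hi'.integrableOn)
  rw [iUnion_Ico_intCast, setIntegral_univ] at h2
  have e : (fun n : ℤ => ∫ x in Set.Ico (n : ℝ) (n + 1), F ⌊x⌋) = F := by
    funext k
    rw [setIntegral_congr_fun (g := fun _ => F k) measurableSet_Ico]
    · simp
    · intro x hx
      simp only
      rw [Int.floor_eq_iff.2 hx]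
  rw [e] at h2
  exact h2

lemma eta_riemann (h : ℕ → ℝ) (hh : ∀ᶠ n in atTop, 0 < h n) (F : ℕ → ℤ → ℝ) (G b : ℝ → ℝ)
    (hb : Integrable b)
    (hF : ∀ᶠ n in atTop, ∀ x : ℝ, |F n ⌊x / h n⌋| ≤ b x)
    (hG : ∀ x : ℝ, x ≠ 0 → Tendsto (fun n => F n ⌊x / h n⌋) atTop (𝓝 (G x))) :
    (∀ᶠ n in atTop, Summable (F n)) ∧
    Tendsto (fun n => h n * ∑' k, F n k) atTop (𝓝 (∫ x, G x)) := by
  have hm : ∀ n, AEStronglyMeasurable (fun x : ℝ => F n ⌊x / h n⌋) volume := by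
    intro n
    have : Measurable (F n) := measurable_from_top
    exact (this.comp (Int.measurable_floor.comp (measurable_id.div_const (h n)))).aestronglyMeasurable
  have hs : ∀ᶠ n in atTop, HasSum (fun k => h n * F n k) (∫ x : ℝ, F n ⌊x / h n⌋) := by
    filter_upwards [hh, hF] with n h1 h2
    exact eta_hasSum_floor _ h1 _ (hb.mono' (hm n) (Eventually.of_forall h2))
  constructor
  · filter_upwards [hs, hh] with n h1 h2
    exact (summable_mul_left_iff h2.ne').1 h1.summable
  · have : Tendsto (fun n => ∫ x : ℝ, F n ⌊x / h n⌋) atTop (𝓝 (∫ x, G x)) := by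
      apply tendsto_integral_filter_of_dominated_convergence b
      · exact Eventually.of_forall hm
      · filter_upwards [hF] with n h2
        exact Eventually.of_forall h2
      · exact hb
      · filter_upwards [compl_mem_ae_iff.2 (measure_singleton (0:ℝ))] with x hx
        exact hG x hx
    refine this.congr' ?_
    filter_upwards [hs] with n h1
    rw [← h1.tsum_eq, tsum_mul_left]

lemma eta_int (n : ℕ) : Integrable (fun x : ℝ => x ^ n * Real.exp (-2 * x ^ 2)) := by
  have := integrable_rpow_mul_exp_neg_mul_sq (b := 2) (by norm_num) (s := n)
    (by have : (0:ℝ) ≤ n := Nat.cast_nonneg n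
        linarith)
  simpa using this

/-- Gaussian integral. -/
def etaI : ℝ := ∫ x : ℝ, Real.exp (-2 * x ^ 2)

lemma etaI_pos : 0 < etaI := by
  unfold etaI
  rw [integral_gaussian]
  positivity

lemma eta_hd (n : ℕ) (x : ℝ) : HasDerivAt (fun x : ℝ => x ^ (n+1) * Real.exp (-2 * x ^ 2))
    ((n+1) * (x ^ n * Real.exp (-2 * x ^ 2)) - 4 * (x ^ (n+2) * Real.exp (-2 * x ^ 2))) x := by
  have h1 := (hasDerivAt_pow (n+1) x).mul (((hasDerivAt_pow 2 x).const_mul (-2:ℝ)).exp)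
  refine h1.congr_deriv ?_
  push_cast
  simp
  ring

lemma eta_rec (n : ℕ) : (n+1) * (∫ x : ℝ, x ^ n * Real.exp (-2 * x ^ 2))
    = 4 * ∫ x : ℝ, x ^ (n+2) * Real.exp (-2 * x ^ 2) := by
  have := integral_eq_zero_of_hasDerivAt_of_integrable (eta_hd n)
    (((eta_int n).const_mul _).sub ((eta_int (n+2)).const_mul _)) (eta_int (n+1))
  rw [integral_sub ((eta_int n).const_mul _) ((eta_int (n+2)).const_mul _),
    integral_const_mul, integral_const_mul] at this
  linarith

lemma eta_I2 : (∫ x : ℝ, x ^ 2 * Real.exp (-2 * x ^ 2)) = etaI / 4 := by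
  have := eta_rec 0
  simp at this
  unfold etaI
  simp
  linarith

lemma eta_I4 : (∫ x : ℝ, x ^ 4 * Real.exp (-2 * x ^ 2)) = 3 / 16 * etaI := by
  have := eta_rec 2
  rw [eta_I2] at this
  norm_num at this
  simp
  linarith

lemma eta_ID : (∫ x : ℝ, (1 - 2 * x ^ 2) ^ 2 * Real.exp (-2 * x ^ 2)) = 3 / 4 * etaI := by
  have e : (fun x : ℝ => (1 - 2 * x ^ 2) ^ 2 * Real.exp (-2 * x ^ 2)) = fun x =>
    (x ^ 0 * Real.exp (-2 * x ^ 2) - 4 * (x ^ 2 * Real.exp (-2 * x ^ 2)))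
      + 4 * (x ^ 4 * Real.exp (-2 * x ^ 2)) := by
    funext x; ring
  have h0 : (∫ x : ℝ, x ^ 0 * Real.exp (-2 * x ^ 2)) = etaI := by
    unfold etaI; simp
  have hi : Integrable (fun x : ℝ => x ^ 0 * Real.exp (-2 * x ^ 2)
      - 4 * (x ^ 2 * Real.exp (-2 * x ^ 2))) := (eta_int 0).sub ((eta_int 2).const_mul _)
  rw [e, integral_add hi ((eta_int 4).const_mul _),
    integral_sub (eta_int 0) ((eta_int 2).const_mul _), integral_const_mul, integral_const_mul,
    eta_I2, eta_I4, h0]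
  ring

/-- `(1 - exp(-s u))/s`. -/
def etaG (s u : ℝ) : ℝ := (1 - Real.exp (-(s * u))) / s

lemma etaG_le {s u : ℝ} (hs : 0 < s) : etaG s u ≤ u := by
  unfold etaG
  rw [div_le_iff₀ hs]
  have := Real.add_one_le_exp (-(s * u))
  linarith

lemma etaG_ge {s u : ℝ} (hs : 0 < s) : u * Real.exp (-(s * u)) ≤ etaG s u := by
  unfold etaG
  rw [le_div_iff₀ hs]
  have h1 := Real.add_one_le_exp (s * u)
  have h2 : Real.exp (-(s * u)) * Real.exp (s * u) = 1 := by
    rw [← Real.exp_add]; simp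
  have h3 := Real.exp_pos (-(s * u))
  nlinarith

lemma etaG_pos {s u : ℝ} (hs : 0 < s) (hu : 0 < u) : 0 < etaG s u :=
  lt_of_lt_of_le (mul_pos hu (Real.exp_pos _)) (etaG_ge hs)

lemma etaG_hd {s : ℝ} (hs : 0 < s) (b y : ℝ) :
    HasDerivAt (fun y => etaG s (y ^ 2 + b)) (2 * y * Real.exp (-(s * (y ^ 2 + b)))) y := by
  unfold etaG
  have h1 := ((((((hasDerivAt_pow 2 y).add_const b).const_mul s).neg).exp).const_sub 1).div_const s
  refine h1.congr_deriv ?_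
  field_simp
  simp
  ring

/-- The rescaled modulus. -/
def etaR (s b y : ℝ) : ℝ := Real.sqrt (etaG s (y ^ 2 + b)) * Real.exp (-(y ^ 2 + b))

/-- Its derivative. -/
def etaR' (s b y : ℝ) : ℝ :=
  2 * y * (Real.exp (-(s * (y ^ 2 + b))) / (2 * Real.sqrt (etaG s (y ^ 2 + b)))
    - Real.sqrt (etaG s (y ^ 2 + b))) * Real.exp (-(y ^ 2 + b))

lemma etaR_hd {s b : ℝ} (hs : 0 < s) (hb : 0 < b) (y : ℝ) :
    HasDerivAt (etaR s b) (etaR' s b y) y := by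
  have hp : 0 < etaG s (y ^ 2 + b) := etaG_pos hs (by positivity)
  have h1 := ((etaG_hd hs b y).sqrt hp.ne').mul (((hasDerivAt_pow 2 y).add_const b).neg.exp)
  refine h1.congr_deriv ?_
  unfold etaR'
  simp
  ring

lemma etaR_sq {s b : ℝ} (hs : 0 < s) (hb : 0 < b) (y : ℝ) :
    etaR s b y ^ 2 = etaG s (y ^ 2 + b) * Real.exp (-2 * (y ^ 2 + b)) := by
  have hp : 0 < etaG s (y ^ 2 + b) := etaG_pos hs (by positivity)
  unfold etaR
  rw [mul_pow, Real.sq_sqrt hp.le, ← Real.exp_nat_mul]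
  congr 2
  push_cast; ring

lemma etaR_sq_le {s b : ℝ} (hs : 0 < s) (hb : 0 < b) (y : ℝ) :
    etaR s b y ^ 2 ≤ Real.exp (-y ^ 2) := by
  rw [etaR_sq hs hb]
  have h1 := etaG_le (u := y ^ 2 + b) hs
  set u := y ^ 2 + b with hu
  have h2 : Real.exp (-2 * u) = Real.exp (-u) * Real.exp (-u) := by rw [← Real.exp_add]; ring_nf
  have h3 : u * Real.exp (-u) ≤ 1 := by
    have := Real.add_one_le_exp u
    rw [Real.exp_neg, ← div_eq_mul_inv, div_le_one (Real.exp_pos _)]; linarith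
  have h4 : Real.exp (-u) ≤ Real.exp (-y^2) := Real.exp_le_exp.2 (by linarith)
  have h5 := Real.exp_pos (-u)
  calc etaG s u * Real.exp (-2 * u) ≤ u * Real.exp (-2 * u) := by gcongr
    _ = (u * Real.exp (-u)) * Real.exp (-u) := by rw [h2]; ring
    _ ≤ 1 * Real.exp (-u) := by gcongr
    _ ≤ _ := by linarith

lemma etaR_sq_le' {s b : ℝ} (hs : 0 < s) (hb : 0 < b) (y : ℝ) :
    y ^ 2 * etaR s b y ^ 2 ≤ 4 * Real.exp (-y ^ 2) := by
  rw [etaR_sq hs hb]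
  have h1 := etaG_le (u := y ^ 2 + b) hs
  have h0 : y ^ 2 ≤ y ^ 2 + b := by linarith
  have hp : 0 < etaG s (y ^ 2 + b) := etaG_pos hs (by positivity)
  have hup : 0 < y ^ 2 + b := by positivity
  set u := y ^ 2 + b with hu
  have h2 : Real.exp (-2 * u) = Real.exp (-(u/2)) * Real.exp (-(u/2)) * Real.exp (-u) := by
    rw [← Real.exp_add, ← Real.exp_add]; ring_nf
  have h3 : u * Real.exp (-(u/2)) ≤ 2 := by
    have := Real.add_one_le_exp (u/2)
    rw [Real.exp_neg, ← div_eq_mul_inv, div_le_iff₀ (Real.exp_pos _)]; linarith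
  have h4 : Real.exp (-u) ≤ Real.exp (-y^2) := Real.exp_le_exp.2 (by linarith)
  have h5 := Real.exp_pos (-u)
  calc y ^ 2 * (etaG s u * Real.exp (-2 * u)) ≤ u * (u * Real.exp (-2 * u)) := by gcongr
    _ = (u * Real.exp (-(u/2))) * (u * Real.exp (-(u/2))) * Real.exp (-u) := by rw [h2]; ring
    _ ≤ 2 * 2 * Real.exp (-u) := by gcongr
    _ ≤ _ := by linarith

lemma etaR'_le {s b : ℝ} (hs : 0 < s) (hb : 0 < b) (y : ℝ) :
    etaR' s b y ^ 2 ≤ 16 * Real.exp (-y ^ 2) := by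
  have hup : 0 < y ^ 2 + b := by positivity
  have hyu : |y| ≤ Real.sqrt (y ^ 2 + b) := Real.abs_le_sqrt (by linarith)
  have hyu' : y ^ 2 ≤ y ^ 2 + b := by linarith
  unfold etaR'
  set u := y ^ 2 + b with hu
  have hp : 0 < etaG s u := etaG_pos hs hup
  set w := Real.sqrt (etaG s u) with hw
  have hwp : 0 < w := Real.sqrt_pos.2 hp
  have hw1 : w ≤ Real.sqrt u := Real.sqrt_le_sqrt (etaG_le hs)
  have hsu : 0 < Real.sqrt u := Real.sqrt_pos.2 hup
  have hss : Real.sqrt u * Real.sqrt u = u := Real.mul_self_sqrt hup.le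
  -- lower bound on w
  set e := Real.exp (-(s * u)) with he
  have hep : 0 < e := Real.exp_pos _
  have he1 : e ≤ 1 := Real.exp_le_one_iff.2 (by have := mul_pos hs hup; linarith)
  have hw2 : Real.sqrt u * e ≤ w := by
    apply Real.le_sqrt_of_sq_le
    calc (Real.sqrt u * e) ^ 2 = u * e * e := by
          rw [mul_pow, Real.sq_sqrt hup.le]; ring
      _ ≤ u * e * 1 := by gcongr
      _ ≤ _ := by rw [mul_one]; exact etaG_ge hs
  have hA : |2 * y * (e / (2 * w) - w)| ≤ 1 + 2 * u := by
    have e1 : |y| * (e / w) ≤ 1 := by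
      rw [← mul_div_assoc, div_le_one hwp]
      exact le_trans (by gcongr) hw2
    have e2 : |y| * w ≤ u := by
      rw [← hss]; gcongr
    have e3 : 2 * y * (e / (2 * w) - w) = y * (e / w) - 2 * (y * w) := by
      field_simp
    rw [e3]
    refine (abs_sub _ _).trans ?_
    rw [abs_mul, abs_mul, abs_mul, abs_of_pos (div_pos hep hwp), abs_of_pos hwp, abs_two]
    linarith
  have hB : (1 + 2 * u) * Real.exp (-(u/2)) ≤ 4 := by
    have := Real.add_one_le_exp (u/2)
    rw [Real.exp_neg, ← div_eq_mul_inv, div_le_iff₀ (Real.exp_pos _)]; linarith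
  have h2 : Real.exp (-u) ^ 2 = Real.exp (-(u/2)) ^ 2 * Real.exp (-u) := by
    rw [← Real.exp_nat_mul, ← Real.exp_nat_mul, ← Real.exp_add]; push_cast; ring_nf
  have h4 : Real.exp (-u) ≤ Real.exp (-y^2) := Real.exp_le_exp.2 (by linarith)
  calc (2 * y * (e / (2 * w) - w) * Real.exp (-u)) ^ 2
      = |2 * y * (e / (2 * w) - w)| ^ 2 * Real.exp (-u) ^ 2 := by rw [sq_abs]; ring
    _ ≤ (1 + 2 * u) ^ 2 * Real.exp (-u) ^ 2 := by gcongr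
    _ = ((1 + 2 * u) * Real.exp (-(u/2))) ^ 2 * Real.exp (-u) := by rw [h2]; ring
    _ ≤ 4 ^ 2 * Real.exp (-u) := by gcongr
    _ ≤ _ := by linarith

lemma eta_gauss_shift {x ξ : ℝ} (h : |x - ξ| ≤ 1) :
    Real.exp (-ξ ^ 2) ≤ Real.exp 1 * Real.exp (-(1/2) * x ^ 2) := by
  rw [← Real.exp_add]
  apply Real.exp_le_exp.2
  have := abs_le.1 h
  nlinarith [sq_nonneg (x - 2 * ξ)]

lemma etaG_tendsto {s u : ℕ → ℝ} {v : ℝ} (hs : ∀ᶠ n in atTop, 0 < s n)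
    (hs0 : Tendsto s atTop (𝓝 0)) (hu : Tendsto u atTop (𝓝 v)) :
    Tendsto (fun n => etaG (s n) (u n)) atTop (𝓝 v) := by
  have h1 : Tendsto (fun n => u n * Real.exp (-(s n * u n))) atTop (𝓝 v) := by
    have := hu.mul ((Real.continuous_exp.tendsto _).comp (hs0.mul hu).neg)
    simpa using this
  refine tendsto_of_tendsto_of_tendsto_of_le_of_le' h1 hu ?_ ?_
  · filter_upwards [hs] with n hn using etaG_ge hn
  · filter_upwards [hs] with n hn using etaG_le hn

lemma etaRsq_tendsto {s b y : ℕ → ℝ} {x : ℝ} (hs : ∀ᶠ n in atTop, 0 < s n)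
    (hb : ∀ᶠ n in atTop, 0 < b n)
    (hs0 : Tendsto s atTop (𝓝 0)) (hb0 : Tendsto b atTop (𝓝 0)) (hy : Tendsto y atTop (𝓝 x)) :
    Tendsto (fun n => etaR (s n) (b n) (y n) ^ 2) atTop (𝓝 (x ^ 2 * Real.exp (-2 * x ^ 2))) := by
  have hu : Tendsto (fun n => y n ^ 2 + b n) atTop (𝓝 (x ^ 2)) := by
    simpa using (hy.pow 2).add hb0
  have h1 := (etaG_tendsto hs hs0 hu).mul
    ((Real.continuous_exp.tendsto _).comp (hu.const_mul (-2)))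
  refine h1.congr' ?_
  filter_upwards [hs, hb] with n h2 h3
  rw [etaR_sq h2 h3]; rfl

lemma etaR'_tendsto {s b y : ℕ → ℝ} {x : ℝ} (hx : x ≠ 0) (hs : ∀ᶠ n in atTop, 0 < s n)
    (hs0 : Tendsto s atTop (𝓝 0)) (hb0 : Tendsto b atTop (𝓝 0)) (hy : Tendsto y atTop (𝓝 x)) :
    Tendsto (fun n => etaR' (s n) (b n) (y n) ^ 2) atTop
      (𝓝 ((1 - 2 * x ^ 2) ^ 2 * Real.exp (-2 * x ^ 2))) := by
  have hu : Tendsto (fun n => y n ^ 2 + b n) atTop (𝓝 (x ^ 2)) := by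
    simpa using (hy.pow 2).add hb0
  have hw : Tendsto (fun n => Real.sqrt (etaG (s n) (y n ^ 2 + b n))) atTop (𝓝 |x|) := by
    rw [← Real.sqrt_sq_eq_abs]
    exact (Real.continuous_sqrt.tendsto _).comp (etaG_tendsto hs hs0 hu)
  have he : Tendsto (fun n => Real.exp (-(s n * (y n ^ 2 + b n)))) atTop (𝓝 1) := by
    have := (Real.continuous_exp.tendsto _).comp (hs0.mul hu).neg
    simp only [zero_mul, neg_zero, Real.exp_zero] at this
    exact this
  have he2 : Tendsto (fun n => Real.exp (-(y n ^ 2 + b n))) atTop (𝓝 (Real.exp (-x ^ 2))) :=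
    (Real.continuous_exp.tendsto _).comp hu.neg
  have hax : 0 < |x| := abs_pos.2 hx
  have h := ((((hy.const_mul 2).mul ((he.div (hw.const_mul 2) (by positivity)).sub hw)).mul he2).pow 2)
  have e : (2 * x * (1 / (2 * |x|) - |x|) * Real.exp (-x ^ 2)) ^ 2
      = (1 - 2 * x ^ 2) ^ 2 * Real.exp (-2 * x ^ 2) := by
    have e1 : Real.exp (-2 * x ^ 2) = Real.exp (-x ^ 2) ^ 2 := by
      rw [← Real.exp_nat_mul]; push_cast; ring_nf
    have e2 : 2 * x * (1 / (2 * |x|) - |x|) = x / |x| * (1 - 2 * |x| ^ 2) := by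
      field_simp
    rw [e1, e2, sq_abs, mul_pow, mul_pow, div_pow, sq_abs, div_self (by positivity)]
    ring
  rw [e] at h
  exact h

lemma eta_floor {h : ℝ} (hh : 0 < h) (x : ℝ) :
    h * (⌊x / h⌋ : ℝ) ≤ x ∧ x < h * (⌊x / h⌋ : ℝ) + h := by
  have h1 := Int.floor_le (x / h)
  have h2 := Int.lt_floor_add_one (x / h)
  rw [le_div_iff₀ hh] at h1
  rw [div_lt_iff₀ hh] at h2
  constructor <;> linarith

lemma eta_floor_tendsto {h : ℕ → ℝ} (hh : ∀ᶠ n in atTop, 0 < h n) (h0 : Tendsto h atTop (𝓝 0))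
    {x : ℝ} {y : ℕ → ℝ} (hy : ∀ᶠ n in atTop, |x - y n| ≤ h n) : Tendsto y atTop (𝓝 x) := by
  rw [tendsto_iff_dist_tendsto_zero]
  refine squeeze_zero' (Eventually.of_forall fun _ => dist_nonneg) ?_ h0
  filter_upwards [hy] with n hn
  rw [dist_comm, Real.dist_eq]; exact hn

lemma eta_slope {s b : ℝ} (hs : 0 < s) (hb : 0 < b) {h : ℝ} (hh : 0 < h) (y : ℝ) :
    ∃ ξ, y ≤ ξ ∧ ξ ≤ y + h ∧ (etaR s b (y + h) - etaR s b y) / h = etaR' s b ξ := by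
  obtain ⟨c, hc, hc'⟩ := exists_hasDerivAt_eq_slope (etaR s b) (etaR' s b)
    (by linarith : y < y + h)
    (fun z _ => (etaR_hd hs hb z).continuousAt.continuousWithinAt) (fun z _ => etaR_hd hs hb z)
  refine ⟨c, hc.1.le, hc.2.le, ?_⟩
  rw [hc']; congr 1; ring

section lims
variable {h s b : ℕ → ℝ}

lemma eta_bound_int : Integrable (fun x : ℝ => 16 * (Real.exp 1 * Real.exp (-(1/2) * x ^ 2))) :=
  ((integrable_exp_neg_mul_sq (by norm_num)).const_mul _).const_mul _

lemma eta_lim1 (hh : ∀ᶠ n in atTop, 0 < h n) (h0 : Tendsto h atTop (𝓝 0))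
    (hs : ∀ᶠ n in atTop, 0 < s n) (hs0 : Tendsto s atTop (𝓝 0))
    (hb : ∀ᶠ n in atTop, 0 < b n) (hb0 : Tendsto b atTop (𝓝 0)) :
    (∀ᶠ n in atTop, Summable (fun k : ℤ => etaR (s n) (b n) (h n * k) ^ 2)) ∧
    Tendsto (fun n => h n * ∑' k : ℤ, etaR (s n) (b n) (h n * k) ^ 2) atTop (𝓝 (etaI / 4)) := by
  rw [← eta_I2]
  refine eta_riemann h hh (fun n k => etaR (s n) (b n) (h n * k) ^ 2) _ _ eta_bound_int ?_ ?_
  · filter_upwards [hh, hs, hb, h0.eventually (ge_mem_nhds one_pos)] with n h1 h2 h3 h4 x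
    have hf := eta_floor h1 x
    have e1 := etaR_sq_le h2 h3 (h n * (⌊x / h n⌋ : ℝ))
    have e2 := eta_gauss_shift (x := x) (ξ := h n * (⌊x / h n⌋ : ℝ))
      (by rw [abs_le]; constructor <;> linarith)
    have e3 := Real.exp_pos (-(h n * (⌊x / h n⌋ : ℝ)) ^ 2)
    rw [abs_of_nonneg (sq_nonneg _)]
    linarith
  · intro x hx
    refine etaRsq_tendsto hs hb hs0 hb0 (eta_floor_tendsto hh h0 ?_)
    filter_upwards [hh] with n h1
    have hf := eta_floor h1 x
    rw [abs_le]; constructor <;> linarith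

lemma eta_lim2 (hh : ∀ᶠ n in atTop, 0 < h n) (h0 : Tendsto h atTop (𝓝 0))
    (hs : ∀ᶠ n in atTop, 0 < s n) (hs0 : Tendsto s atTop (𝓝 0))
    (hb : ∀ᶠ n in atTop, 0 < b n) (hb0 : Tendsto b atTop (𝓝 0)) :
    Tendsto (fun n => h n * ∑' k : ℤ, (h n * k) ^ 2 * etaR (s n) (b n) (h n * k) ^ 2) atTop
      (𝓝 (3 / 16 * etaI)) := by
  rw [← eta_I4]
  refine (eta_riemann h hh (fun n k => (h n * k) ^ 2 * etaR (s n) (b n) (h n * k) ^ 2) _ _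
    eta_bound_int ?_ ?_).2
  · filter_upwards [hh, hs, hb, h0.eventually (ge_mem_nhds one_pos)] with n h1 h2 h3 h4 x
    have hf := eta_floor h1 x
    have e1 := etaR_sq_le' h2 h3 (h n * (⌊x / h n⌋ : ℝ))
    have e2 := eta_gauss_shift (x := x) (ξ := h n * (⌊x / h n⌋ : ℝ))
      (by rw [abs_le]; constructor <;> linarith)
    have e3 := Real.exp_pos (-(h n * (⌊x / h n⌋ : ℝ)) ^ 2)
    rw [abs_of_nonneg (by positivity)]
    linarith
  · intro x hx
    have hy : Tendsto (fun n => h n * (⌊x / h n⌋ : ℝ)) atTop (𝓝 x) := by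
      refine eta_floor_tendsto hh h0 ?_
      filter_upwards [hh] with n h1
      have hf := eta_floor h1 x
      rw [abs_le]; constructor <;> linarith
    have := (hy.pow 2).mul (etaRsq_tendsto hs hb hs0 hb0 hy)
    rw [← mul_assoc, ← pow_add] at this
    exact this

lemma eta_lim3 (hh : ∀ᶠ n in atTop, 0 < h n) (h0 : Tendsto h atTop (𝓝 0))
    (hs : ∀ᶠ n in atTop, 0 < s n) (hs0 : Tendsto s atTop (𝓝 0))
    (hb : ∀ᶠ n in atTop, 0 < b n) (hb0 : Tendsto b atTop (𝓝 0)) :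
    (∀ᶠ n in atTop, Summable (fun k : ℤ => ((etaR (s n) (b n) (h n * k + h n)
      - etaR (s n) (b n) (h n * k)) / h n) ^ 2)) ∧
    Tendsto (fun n => h n * ∑' k : ℤ, ((etaR (s n) (b n) (h n * k + h n)
      - etaR (s n) (b n) (h n * k)) / h n) ^ 2) atTop (𝓝 (3 / 4 * etaI)) := by
  rw [← eta_ID]
  have key : ∀ n, ∀ y : ℝ, ∃ ξ, 0 < h n → 0 < s n → 0 < b n → (y ≤ ξ ∧ ξ ≤ y + h n ∧
      (etaR (s n) (b n) (y + h n) - etaR (s n) (b n) y) / h n = etaR' (s n) (b n) ξ) := by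
    intro n y
    by_cases hc : 0 < h n ∧ 0 < s n ∧ 0 < b n
    · obtain ⟨ξ, hξ⟩ := eta_slope hc.2.1 hc.2.2 hc.1 y
      exact ⟨ξ, fun _ _ _ => hξ⟩
    · exact ⟨0, fun h1 h2 h3 => absurd ⟨h1, h2, h3⟩ hc⟩
  choose ξ hξ using key
  refine eta_riemann h hh (fun n k => ((etaR (s n) (b n) (h n * k + h n)
      - etaR (s n) (b n) (h n * k)) / h n) ^ 2) _ _ eta_bound_int ?_ ?_
  · filter_upwards [hh, hs, hb, h0.eventually (ge_mem_nhds one_pos)] with n h1 h2 h3 h4 x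
    have hf := eta_floor h1 x
    obtain ⟨g1, g2, g3⟩ := hξ n (h n * (⌊x / h n⌋ : ℝ)) h1 h2 h3
    rw [g3]
    have e1 := etaR'_le h2 h3 (ξ n (h n * (⌊x / h n⌋ : ℝ)))
    have e2 := eta_gauss_shift (x := x) (ξ := ξ n (h n * (⌊x / h n⌋ : ℝ)))
      (by rw [abs_le]; constructor <;> linarith)
    rw [abs_of_nonneg (sq_nonneg _)]
    linarith
  · intro x hx
    have hy : Tendsto (fun n => ξ n (h n * (⌊x / h n⌋ : ℝ))) atTop (𝓝 x) := by
      refine eta_floor_tendsto hh h0 ?_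
      filter_upwards [hh, hs, hb] with n h1 h2 h3
      have hf := eta_floor h1 x
      obtain ⟨g1, g2, g3⟩ := hξ n (h n * (⌊x / h n⌋ : ℝ)) h1 h2 h3
      rw [abs_le]; constructor <;> linarith
    refine (etaR'_tendsto hx hs hs0 hb0 hy).congr' ?_
    filter_upwards [hh, hs, hb] with n h1 h2 h3
    obtain ⟨g1, g2, g3⟩ := hξ n (h n * (⌊x / h n⌋ : ℝ)) h1 h2 h3
    rw [g3]

end lims

lemma eta_UC_formula (c : ℤ → ℂ) (R : ℤ → ℝ) (σ θ h A B C : ℝ) (hσ : 0 < σ) (hh : 0 < h)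
    (hc : ∀ k, c k = Complex.exp (((θ * k : ℝ) : ℂ) * Complex.I) * ((σ * R k : ℝ) : ℂ))
    (heven : ∀ k, R (-k) = R k)
    (hs1 : Summable (fun k => R k ^ 2)) (hs2 : Summable (fun k => ((R (k + 1) - R k) / h) ^ 2))
    (hA : A = h * ∑' k, R k ^ 2) (hB : B = h * ∑' k, ((R (k + 1) - R k) / h) ^ 2)
    (hC : C = h * ∑' k : ℤ, (h * k) ^ 2 * R k ^ 2)
    (hA0 : A ≠ 0) (hT0 : A - h ^ 2 * B / 2 ≠ 0) :
    UC c = Real.sqrt (B / 2 * (A + (A - h ^ 2 * B / 2)) * C / ((A - h ^ 2 * B / 2) ^ 2 * A)) := by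
  have hn : ∀ k, ‖c k‖ ^ 2 = σ ^ 2 * R k ^ 2 := by
    intro k
    rw [hc, norm_mul, Complex.norm_exp_ofReal_mul_I, one_mul, Complex.norm_real, Real.norm_eq_abs,
      sq_abs, mul_pow]
  have hS : ∑' k, ‖c k‖ ^ 2 = σ ^ 2 * (A / h) := by
    simp_rw [hn]
    rw [tsum_mul_left, hA]
    field_simp
  have hM : ∑' k : ℤ, (k : ℝ) ^ 2 * ‖c k‖ ^ 2 = σ ^ 2 * (C / h ^ 3) := by
    have : ∀ k : ℤ, (k : ℝ) ^ 2 * ‖c k‖ ^ 2 = σ ^ 2 / h ^ 2 * ((h * k) ^ 2 * R k ^ 2) := by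
      intro k
      rw [hn]; field_simp
    simp_rw [this]
    rw [tsum_mul_left, hC]
    field_simp
  have hO : ∑' k : ℤ, (k : ℝ) * ‖c k‖ ^ 2 = 0 := by
    have e := (Equiv.neg ℤ).tsum_eq (fun k : ℤ => (k : ℝ) * ‖c k‖ ^ 2)
    have e2 : ∀ k : ℤ, (((Equiv.neg ℤ) k : ℤ) : ℝ) * ‖c ((Equiv.neg ℤ) k)‖ ^ 2
        = -((k : ℝ) * ‖c k‖ ^ 2) := by
      intro k
      rw [hn, hn, Equiv.neg_apply, heven]; push_cast; ring
    simp_rw [e2] at e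
    rw [tsum_neg] at e
    linarith
  have hRR : ∑' k, R k * R (k + 1) = (A - h ^ 2 * B / 2) / h := by
    have hs1' : Summable (fun k => R (k + 1) ^ 2) :=
      (Equiv.addRight (1:ℤ)).summable_iff.2 hs1
    have e1 : ∑' k, R (k + 1) ^ 2 = ∑' k, R k ^ 2 :=
      (Equiv.addRight (1:ℤ)).tsum_eq (fun k => R k ^ 2)
    have e : ∀ k, R k * R (k + 1) = (1/2 * R k ^ 2 + 1/2 * R (k + 1) ^ 2)
        - h ^ 2 / 2 * ((R (k + 1) - R k) / h) ^ 2 := by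
      intro k; field_simp; ring
    simp_rw [e]
    rw [((hs1.mul_left _).add (hs1'.mul_left _)).tsum_sub (hs2.mul_left _),
      (hs1.mul_left _).tsum_add (hs1'.mul_left _), tsum_mul_left, tsum_mul_left, tsum_mul_left,
      e1, hA, hB]
    field_simp
    ring
  have hT : ‖trigSum c‖ ^ 2 = (σ ^ 2 * ((A - h ^ 2 * B / 2) / h)) ^ 2 := by
    have e : ∀ k, c k * (starRingEnd ℂ) (c (k + 1)) =
        Complex.exp (((-θ : ℝ) : ℂ) * Complex.I) * ((σ ^ 2 * (R k * R (k + 1)) : ℝ) : ℂ) := by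
      intro k
      rw [hc, hc, map_mul, ← Complex.exp_conj, map_mul, Complex.conj_I, Complex.conj_ofReal,
        Complex.conj_ofReal]
      have : Complex.exp (((-θ : ℝ) : ℂ) * Complex.I) =
        Complex.exp (((θ * k : ℝ) : ℂ) * Complex.I) *
          Complex.exp (((θ * (k + 1 : ℤ) : ℝ) : ℂ) * -Complex.I) := by
        rw [← Complex.exp_add]; congr 1; push_cast; ring
      rw [this]; push_cast; ring
    unfold trigSum
    simp_rw [e]
    rw [tsum_mul_left, ← Complex.ofReal_tsum, norm_mul, Complex.norm_exp_ofReal_mul_I, one_mul,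
      Complex.norm_real, Real.norm_eq_abs, sq_abs, tsum_mul_left, hRR]
  unfold UC varA varF
  rw [hT, hO, hS, hM]
  congr 1
  have hpi := Real.pi_pos
  generalize hTT : A - h ^ 2 * B / 2 = T at *
  have hBB : B = 2 * (A - T) / h ^ 2 := by
    rw [← hTT]; field_simp; ring
  rw [hBB]
  field_simp
  ring

lemma etaR_even (s b y : ℝ) : etaR s b (-y) = etaR s b y := by
  unfold etaR; rw [neg_sq]

lemma eta_coeff (j : ℕ) (hj : 0 < j) (a : ℝ) (ha : 1 < a) (k : ℤ) :
    etaHat j a k = Complex.exp (((2 * Real.pi * (2:ℝ) ^ (-(j:ℝ) - 1) * k : ℝ) : ℂ) * Complex.I) *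
      ((Real.sqrt (2 / j) * etaR (2 / j) (a ^ 2 * (1 / Real.sqrt ((j + 1) * a)) ^ 2)
        ((1 / Real.sqrt ((j + 1) * a)) * k) : ℝ) : ℂ) := by
  have hj' : (0:ℝ) < j := Nat.cast_pos.2 hj
  have ha0 : 0 < a := by linarith
  have hN : 0 < ((j:ℝ) + 1) * a := by positivity
  have hq : (1 / Real.sqrt (((j:ℝ) + 1) * a)) ^ 2 = 1 / (((j:ℝ) + 1) * a) := by
    rw [div_pow, Real.sq_sqrt hN.le, one_pow]
  have hu : ((1 / Real.sqrt (((j:ℝ) + 1) * a)) * k) ^ 2 + a ^ 2 * (1 / Real.sqrt (((j:ℝ) + 1) * a)) ^ 2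
      = ((k:ℝ) ^ 2 + a ^ 2) / (((j:ℝ) + 1) * a) := by
    rw [mul_pow, hq]; ring
  unfold etaHat etaR etaG
  rw [hu]
  congr 1
  · congr 1
    push_cast; ring
  · congr 1
    rw [← mul_assoc, ← Real.sqrt_mul (by positivity)]
    congr 2
    rw [mul_div_cancel₀ _ (by positivity)]
    congr 3
    field_simp

/-- For every fixed `a > 1`, `UC(η_j^{a,0}) → 3/2` as `j → ∞`. -/
theorem UC_eta_tendsto_three_halves (a : ℝ) (ha : 1 < a) :
    Tendsto (fun j : ℕ => UC (etaHat j a)) atTop (nhds (3 / 2)) := by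
  have ha0 : 0 < a := by linarith
  set h : ℕ → ℝ := fun j => 1 / Real.sqrt (((j:ℝ) + 1) * a) with hdef
  set s : ℕ → ℝ := fun j => 2 / (j:ℝ) with sdef
  set b : ℕ → ℝ := fun j => a ^ 2 * h j ^ 2 with bdef
  have hh' : ∀ n, 0 < h n := fun n => by simp only [hdef]; positivity
  have hh : ∀ᶠ n in atTop, 0 < h n := Eventually.of_forall hh'
  have h0 : Tendsto h atTop (𝓝 0) := by
    have h1 : Tendsto (fun j : ℕ => ((j:ℝ) + 1) * a) atTop atTop :=
      (tendsto_atTop_add_const_right _ _ tendsto_natCast_atTop_atTop).atTop_mul_const ha0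
    exact (Real.tendsto_sqrt_atTop.comp h1).const_div_atTop 1
  have hs : ∀ᶠ n in atTop, 0 < s n := by
    filter_upwards [eventually_gt_atTop 0] with n hn
    have : (0:ℝ) < n := Nat.cast_pos.2 hn
    simp only [sdef]; positivity
  have hs0 : Tendsto s atTop (𝓝 0) := tendsto_natCast_atTop_atTop.const_div_atTop 2
  have hb : ∀ᶠ n in atTop, 0 < b n := Eventually.of_forall fun n => by
    have := hh' n
    simp only [bdef]; positivity
  have hb0 : Tendsto b atTop (𝓝 0) := by
    have := (h0.pow 2).const_mul (a ^ 2)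
    simpa using this
  obtain ⟨s1, l1⟩ := eta_lim1 hh h0 hs hs0 hb hb0
  have l2 := eta_lim2 hh h0 hs hs0 hb hb0
  obtain ⟨s3, l3⟩ := eta_lim3 hh h0 hs hs0 hb hb0
  set A : ℕ → ℝ := fun n => h n * ∑' k : ℤ, etaR (s n) (b n) (h n * k) ^ 2 with hA
  set C : ℕ → ℝ := fun n => h n * ∑' k : ℤ, (h n * k) ^ 2 * etaR (s n) (b n) (h n * k) ^ 2 with hC
  set B : ℕ → ℝ := fun n => h n * ∑' k : ℤ, ((etaR (s n) (b n) (h n * k + h n)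
      - etaR (s n) (b n) (h n * k)) / h n) ^ 2 with hB
  have hI := etaI_pos
  have lT : Tendsto (fun n => A n - h n ^ 2 * B n / 2) atTop (𝓝 (etaI / 4)) := by
    have := l1.sub (((h0.pow 2).mul l3).div_const 2)
    simpa using this
  have hlim := (((l3.div_const 2).mul (l1.add lT)).mul l2).div ((lT.pow 2).mul l1)
    (by positivity)
  have hsq := (Real.continuous_sqrt.tendsto _).comp hlim
  have hval : Real.sqrt (3 / 4 * etaI / 2 * (etaI / 4 + etaI / 4) * (3 / 16 * etaI) /
      ((etaI / 4) ^ 2 * (etaI / 4))) = 3 / 2 := by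
    rw [Real.sqrt_eq_iff_mul_self_eq (by positivity) (by norm_num)]
    field_simp
    norm_num
  rw [hval] at hsq
  refine hsq.congr' ?_
  have hI4 : etaI / 4 ≠ 0 := by positivity
  filter_upwards [eventually_gt_atTop 0, s1, s3, l1.eventually_ne hI4, lT.eventually_ne hI4]
    with n hn g1 g3 g4 g5
  symm
  have hsum : ∀ k : ℤ, h n * ((k + 1 : ℤ) : ℝ) = h n * k + h n := by
    intro k; push_cast; ring
  refine eta_UC_formula (etaHat n a) (fun k => etaR (s n) (b n) (h n * k)) (Real.sqrt (s n))
    (2 * Real.pi * (2:ℝ) ^ (-(n:ℝ) - 1)) (h n) (A n) (B n) (C n) ?_ (hh' n)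
    (fun k => eta_coeff n hn a ha k) ?_ g1 ?_ rfl ?_ rfl g4 g5
  · have : (0:ℝ) < n := Nat.cast_pos.2 hn
    simp only [sdef]; positivity
  · intro k
    show etaR (s n) (b n) (h n * ((-k : ℤ) : ℝ)) = etaR (s n) (b n) (h n * k)
    rw [← etaR_even]; congr 1; push_cast; ring
  · simpa only [hsum] using g3
  · simp only [hsum, hB]
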